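/- In the ladder graph P_2 □ P_n, every vertex (i,k) with i ∈ {1,2} and 1 < k < n has strictly negative node resistance curvature: p_{(i,k)} < 0. -/

import Mathlib

open Classical Matrix

/-- The four Penrose conditions characterizing the Moore–Penrose pseudoinverse
of a real square matrix. -/
def IsMoorePenroseInverse {V : Type*} [Fintype V] [DecidableEq V]
    (L P : Matrix V V ℝ) : Prop :=
  L * P * L = L ∧ P * L * P = P ∧ (L * P)ᵀ = L * P ∧ (P * L)ᵀ = P * L

/-- The Moore–Penrose pseudoinverse of a real square matrix. -/
noncomputable def pinv {V : Type*} [Fintype V] [DecidableEq V]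
    (L : Matrix V V ℝ) : Matrix V V ℝ :=
  if h : ∃ P, IsMoorePenroseInverse L P then h.choose else 0

/-- Effective resistance between `x` and `y` computed from a (weighted) Laplacian `L`. -/
noncomputable def effResM {V : Type*} [Fintype V] [DecidableEq V]
    (L : Matrix V V ℝ) (x y : V) : ℝ :=
  pinv L x x + pinv L y y - 2 * pinv L x y

/-- Effective resistance between vertices `x` and `y` of a simple graph `G`. -/
noncomputable def effRes {V : Type*} [Fintype V] [DecidableEq V]
    (G : SimpleGraph V) (x y : V) : ℝ :=
  effResM (G.lapMatrix ℝ) x y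

/-- The node resistance curvature `p_x = 1 - (1/2) ∑_{y ~ x} ω_{x,y}`. -/
noncomputable def curv {V : Type*} [Fintype V] [DecidableEq V]
    (G : SimpleGraph V) (x : V) : ℝ :=
  1 - (1/2) * ∑ y : V, if G.Adj x y then effRes G x y else 0

/-- The grid graph `P_m □ P_n` (vertex `(i,j)` of the paper corresponds to
`(⟨i-1⟩, ⟨j-1⟩) : Fin m × Fin n`). -/
def grid (m n : ℕ) : SimpleGraph (Fin m × Fin n) :=
  (SimpleGraph.pathGraph m).boxProd (SimpleGraph.pathGraph n)

/-- The ladder graph `P_2 □ P_n` (vertex `(i,k)` of the paper corresponds to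
`(⟨i-1⟩, ⟨k-1⟩) : Fin 2 × Fin n`). -/
def ladder (n : ℕ) : SimpleGraph (Fin 2 × Fin n) :=
  (SimpleGraph.pathGraph 2).boxProd (SimpleGraph.pathGraph n)

/-- `α_n`, the effective resistance across the first rung of the ladder `P_2 □ P_n`,
i.e. between the vertices `(1,1)` and `(2,1)` of the paper (junk value `0` for `n = 0`). -/
noncomputable def alpha (n : ℕ) : ℝ :=
  if h : 0 < n then effRes (ladder n) (0, ⟨0, h⟩) (1, ⟨0, h⟩) else 0

lemma mp_unique {V : Type*} [Fintype V] [DecidableEq V] {L P Q : Matrix V V ℝ}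
    (hP : IsMoorePenroseInverse L P) (hQ : IsMoorePenroseInverse L Q) : P = Q := by
  obtain ⟨p1, p2, p3, p4⟩ := hP
  obtain ⟨q1, q2, q3, q4⟩ := hQ
  have e1 : L * P = L * Q := by
    calc L * P = (L * P)ᵀ := p3.symm
      _ = ((L * Q) * (L * P))ᵀ := by rw [← Matrix.mul_assoc, q1]
      _ = (L * P) * (L * Q) := by rw [Matrix.transpose_mul, p3, q3]
      _ = L * Q := by rw [← Matrix.mul_assoc, p1]
  have e2 : P * L = Q * L := by
    calc P * L = (P * L)ᵀ := p4.symm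
      _ = ((P * L) * (Q * L))ᵀ := by
          rw [Matrix.mul_assoc P L, ← Matrix.mul_assoc L Q L, q1]
      _ = (Q * L) * (P * L) := by rw [Matrix.transpose_mul, p4, q4]
      _ = Q * L := by rw [Matrix.mul_assoc Q L, ← Matrix.mul_assoc L P L, p1]
  calc P = P * L * P := p2.symm
    _ = Q * (L * P) := by rw [e2, Matrix.mul_assoc]
    _ = Q := by rw [e1, ← Matrix.mul_assoc, q2]

lemma mp_exists {V : Type*} [Fintype V] [DecidableEq V] {L : Matrix V V ℝ}
    (hL : L.IsSymm) : ∃ P, IsMoorePenroseInverse L P := by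
  have hH : L.IsHermitian := by
    rw [Matrix.IsHermitian, Matrix.conjTranspose_eq_transpose_of_trivial]; exact hL
  obtain ⟨U, d, hU, hL'⟩ : ∃ (U : Matrix V V ℝ) (d : V → ℝ), Uᵀ * U = 1 ∧
      L = U * Matrix.diagonal d * Uᵀ := by
    refine ⟨hH.eigenvectorUnitary, hH.eigenvalues, ?_, ?_⟩
    · have := (Matrix.mem_unitaryGroup_iff').1 hH.eigenvectorUnitary.2
      rwa [Matrix.star_eq_conjTranspose, Matrix.conjTranspose_eq_transpose_of_trivial] at this
    · have := hH.spectral_theorem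
      rw [Unitary.conjStarAlgAut_apply, Matrix.star_eq_conjTranspose,
        Matrix.conjTranspose_eq_transpose_of_trivial] at this
      exact this
  have key : ∀ e f : V → ℝ, (U * Matrix.diagonal e * Uᵀ) * (U * Matrix.diagonal f * Uᵀ)
      = U * Matrix.diagonal (fun i => e i * f i) * Uᵀ := by
    intro e f
    rw [← Matrix.diagonal_mul_diagonal]
    calc _ = U * Matrix.diagonal e * (Uᵀ * U) * Matrix.diagonal f * Uᵀ := by
          simp only [Matrix.mul_assoc]
      _ = _ := by rw [hU]; simp only [Matrix.mul_assoc, Matrix.mul_one, Matrix.one_mul]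
  have ht : ∀ e : V → ℝ, (U * Matrix.diagonal e * Uᵀ)ᵀ = U * Matrix.diagonal e * Uᵀ := by
    intro e
    simp [Matrix.transpose_mul, Matrix.mul_assoc]
  refine ⟨U * Matrix.diagonal (fun i => (d i)⁻¹) * Uᵀ, ?_, ?_, ?_, ?_⟩
  · rw [hL', key, key]
    congr 3; funext i; exact mul_inv_mul_cancel (d i)
  · rw [hL', key, key]
    congr 3; funext i
    by_cases h : d i = 0
    · simp [h]
    · field_simp
  · rw [hL', key, ht]
  · rw [hL', key, ht]

lemma pinv_spec {V : Type*} [Fintype V] [DecidableEq V] {L : Matrix V V ℝ}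
    (hs : L.IsSymm) : IsMoorePenroseInverse L (pinv L) := by
  unfold pinv
  rw [dif_pos (mp_exists hs)]
  exact (mp_exists hs).choose_spec

lemma pinv_symm {V : Type*} [Fintype V] [DecidableEq V] {L : Matrix V V ℝ}
    (hs : L.IsSymm) : (pinv L)ᵀ = pinv L := by
  have hP := pinv_spec hs
  apply mp_unique _ hP
  generalize pinv L = P at *
  obtain ⟨p1, p2, p3, p4⟩ := hP
  have hs' : Lᵀ = L := hs
  refine ⟨?_, ?_, ?_, ?_⟩
  · have := congrArg Matrix.transpose p1
    simpa [Matrix.transpose_mul, hs', Matrix.mul_assoc] using this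
  · have := congrArg Matrix.transpose p2
    simpa [Matrix.transpose_mul, hs', Matrix.mul_assoc] using this
  · rw [Matrix.transpose_mul, hs', Matrix.transpose_transpose, ← p4, Matrix.transpose_mul, hs']
  · rw [Matrix.transpose_mul, hs', Matrix.transpose_transpose, ← p3, Matrix.transpose_mul, hs']

lemma effRes_comm {V : Type*} [Fintype V] [DecidableEq V] (G : SimpleGraph V) (x y : V) :
    effRes G x y = effRes G y x := by
  have hxy : pinv (G.lapMatrix ℝ) x y = pinv (G.lapMatrix ℝ) y x :=
    congrFun (congrFun (pinv_symm (G.isSymm_lapMatrix (R := ℝ))) y) x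
  unfold effRes effResM
  rw [hxy]; ring

lemma effRes_eq {V : Type*} [Fintype V] [DecidableEq V] (G : SimpleGraph V) (x y : V) (v : V → ℝ)
    (h : ∀ z, (∑ w, if G.Adj z w then v z - v w else 0)
      = (if z = x then 1 else 0) - (if z = y then 1 else 0)) :
    effRes G x y = v x - v y := by
  have hs : (G.lapMatrix ℝ).IsSymm := G.isSymm_lapMatrix (R := ℝ)
  have hv : G.lapMatrix ℝ *ᵥ v = Pi.single x 1 - Pi.single y 1 := by
    funext z
    rw [SimpleGraph.lapMatrix_mulVec_apply]
    have := h z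
    simp only [Pi.sub_apply, Pi.single_apply]
    rw [← this, ← Finset.sum_filter, Finset.sum_sub_distrib]
    simp only [Finset.sum_const, nsmul_eq_mul]
    congr 1
    · congr 2
      rw [← SimpleGraph.card_neighborFinset_eq_degree]
      congr 1
      ext w; simp
    · apply Finset.sum_congr _ (fun _ _ => rfl)
      ext w; simp
  unfold effRes effResM
  generalize G.lapMatrix ℝ = L at *
  have hP := pinv_spec hs
  have hPs := pinv_symm hs
  generalize pinv L = P at *
  have hxy : P x y = P y x := congrFun (congrFun hPs y) x
  set e : V → ℝ := Pi.single x 1 - Pi.single y 1 with he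
  have h1 : e ⬝ᵥ (P *ᵥ e) = P x x + P y y - 2 * P x y := by
    simp [he, Matrix.mulVec_sub, sub_dotProduct, dotProduct_sub]
    rw [hxy]; ring
  have h2 : e ⬝ᵥ v = v x - v y := by
    simp [he, sub_dotProduct]
  have h3 : e ⬝ᵥ (P *ᵥ e) = e ⬝ᵥ v := by
    calc e ⬝ᵥ (P *ᵥ e) = (L *ᵥ v) ⬝ᵥ (P *ᵥ (L *ᵥ v)) := by rw [hv]
      _ = v ⬝ᵥ ((L * P * L) *ᵥ v) := by
        rw [← Matrix.mulVec_mulVec, ← Matrix.mulVec_mulVec, Matrix.dotProduct_mulVec v L,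
          ← Matrix.mulVec_transpose, hs]
      _ = e ⬝ᵥ v := by rw [hP.1, hv, dotProduct_comm]
  rw [← h1, h3, h2]

lemma ladder_sum (n : ℕ) (i : Fin 2) (j : Fin n) (F : Fin 2 × Fin n → ℝ) :
    (∑ y, if (ladder n).Adj (i, j) y then F y else 0) =
      F (1 - i, j) + (if h : j.val + 1 < n then F (i, ⟨j.val + 1, h⟩) else 0)
        + (if h : 0 < j.val then F (i, ⟨j.val - 1, by omega⟩) else 0) := by
  have hp : ∀ f : Fin n → ℝ, (∑ y, if (SimpleGraph.pathGraph n).Adj j y then f y else 0) =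
      (if h : j.val + 1 < n then f ⟨j.val + 1, h⟩ else 0)
        + (if h : 0 < j.val then f ⟨j.val - 1, by omega⟩ else 0) := by
    intro f
    have : ∀ y : Fin n, (if (SimpleGraph.pathGraph n).Adj j y then f y else 0) =
        (if j.val + 1 = y.val then f y else 0) + (if y.val + 1 = j.val then f y else 0) := by
      intro y
      rw [SimpleGraph.pathGraph_adj]
      split_ifs <;> first | omega | simp
    simp only [this, Finset.sum_add_distrib]
    congr 1
    · split_ifs with h
      · rw [Finset.sum_eq_single ⟨j.val + 1, h⟩]
        · simp
        · intro b _ hb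
          rw [if_neg]
          intro hh; apply hb; ext; simp [hh]
        · simp
      · apply Finset.sum_eq_zero
        intro y _
        rw [if_neg]; have := y.2; omega
    · split_ifs with h
      · rw [Finset.sum_eq_single ⟨j.val - 1, by omega⟩]
        · rw [if_pos]; simp only; omega
        · intro b _ hb
          rw [if_neg]
          intro hh; apply hb; ext; simp only; omega
        · simp
      · apply Finset.sum_eq_zero
        intro y _
        rw [if_neg]; omega
  have hadj : ∀ a b, (SimpleGraph.pathGraph 2).Adj a b ↔ a ≠ b := by
    intro a b
    rw [SimpleGraph.pathGraph_adj]
    fin_cases a <;> fin_cases b <;> simp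
  rw [Fintype.sum_prod_type, Fin.sum_univ_two, add_assoc, ← hp (fun y => F (i, y))]
  simp only [ladder, SimpleGraph.boxProd_adj, hadj]
  fin_cases i <;> simp [add_comm]

/-- Laplacian of a function on the strip, with reflecting extension. -/
lemma ladder_lap (n : ℕ) (v : Fin 2 → ℤ → ℝ) (h0 : ∀ i, v i (-1) = v i 0)
    (hn : ∀ i, v i n = v i (n - 1)) (i : Fin 2) (j : Fin n) :
    (∑ w : Fin 2 × Fin n, if (ladder n).Adj (i, j) w then
        v i (j.val : ℤ) - v w.1 (w.2.val : ℤ) else 0) =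
      3 * v i (j.val : ℤ) - v i ((j.val : ℤ) + 1) - v i ((j.val : ℤ) - 1)
        - v (1 - i) (j.val : ℤ) := by
  rw [ladder_sum n i j (fun w => v i (j.val : ℤ) - v w.1 (w.2.val : ℤ))]
  have e1 : (if h : j.val + 1 < n then v i (j.val : ℤ) - v i ((j.val + 1 : ℕ) : ℤ) else 0)
      = v i (j.val : ℤ) - v i ((j.val : ℤ) + 1) := by
    split_ifs with h
    · push_cast; rfl
    · have : (j.val : ℤ) = n - 1 := by have := j.2; omega
      rw [this, sub_add_cancel, hn]; ring
  have e2 : (if h : 0 < j.val then v i (j.val : ℤ) - v i ((j.val - 1 : ℕ) : ℤ) else 0)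
      = v i (j.val : ℤ) - v i ((j.val : ℤ) - 1) := by
    split_ifs with h
    · rw [Nat.cast_sub (by omega)]; simp
    · have : (j.val : ℤ) = 0 := by omega
      rw [this, zero_sub, h0]; ring
  simp only [] at *
  rw [e1, e2]; ring

/-- Green's function on the path, up to normalisation. -/
noncomputable def grn (a b : ℤ → ℝ) (C : ℝ) (l j : ℤ) : ℝ :=
  if j ≤ l then a j * b l / C else a l * b j / C

lemma grn_eq (a b : ℤ → ℝ) (C : ℝ) (hC : C ≠ 0)
    (ha : ∀ j, a (j + 1) + a (j - 1) = 4 * a j) (hb : ∀ j, b (j + 1) + b (j - 1) = 4 * b j)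
    (hW : ∀ j, a (j + 1) * b j - a j * b (j + 1) = C) (l j : ℤ) :
    4 * grn a b C l j - grn a b C l (j + 1) - grn a b C l (j - 1) = if j = l then 1 else 0 := by
  unfold grn
  rcases lt_trichotomy j l with h | h | h
  · rw [if_pos (by omega), if_pos (by omega), if_pos (by omega), if_neg (by omega)]
    field_simp
    linear_combination (-b l) * ha j
  · subst h
    rw [if_pos (by omega), if_neg (by omega), if_pos (by omega), if_pos rfl]
    field_simp
    linear_combination (-b j) * ha j + hW j
  · rw [if_neg (by omega : ¬ j ≤ l), if_neg (by omega : ¬ j + 1 ≤ l), if_neg (by omega : ¬ j = l)]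
    by_cases h' : j - 1 ≤ l
    · have : l = j - 1 := by omega
      subst this
      rw [if_pos (by omega)]
      field_simp
      linear_combination (-a (j-1)) * hb j
    · rw [if_neg (by omega)]
      field_simp
      linear_combination (-a l) * hb j

/-- Sign of the row. -/
def sg (r i : Fin 2) : ℝ := if i = r then 1 else -1

lemma sg_neg (r i : Fin 2) : sg r (1 - i) = - sg r i := by
  fin_cases r <;> fin_cases i <;> simp [sg]

lemma one_sub_ne (r : Fin 2) : 1 - r ≠ r := by fin_cases r <;> simp

lemma rung_res (n : ℕ) (a b : ℤ → ℝ) (C : ℝ) (hC : C ≠ 0)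
    (ha : ∀ j, a (j + 1) + a (j - 1) = 4 * a j) (hb : ∀ j, b (j + 1) + b (j - 1) = 4 * b j)
    (hW : ∀ j, a (j + 1) * b j - a j * b (j + 1) = C)
    (ha0 : a (-1) = a 0) (hbn : b n = b (n - 1)) (r : Fin 2) (k : Fin n) :
    effRes (ladder n) (r, k) (1 - r, k) = 2 * (a k.val * b k.val / C) := by
  have hk := k.2
  have g0 : grn a b C k.val (-1) = grn a b C k.val 0 := by
    unfold grn; rw [if_pos (by omega), if_pos (by omega), ha0]
  have gn : grn a b C k.val n = grn a b C k.val (n - 1) := by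
    unfold grn; rw [if_neg (by omega)]
    split_ifs with h
    · have : (k.val : ℤ) = n - 1 := by omega
      rw [this, hbn]
    · rw [hbn]
  rw [effRes_eq (ladder n) _ _ (fun w => sg r w.1 * grn a b C k.val w.2.val)]
  · simp only [sg_neg]
    simp [sg, grn]; ring
  · rintro ⟨i, j⟩
    have := ladder_lap n (fun i j => sg r i * grn a b C k.val j)
      (fun i => by simp only [g0]) (fun i => by simp only [gn]) i j
    simp only at this ⊢
    rw [this, sg_neg]
    have h2 := grn_eq a b C hC ha hb hW k.val j.val
    have h3 : ((j.val : ℤ) = k.val) ↔ j = k := by rw [Fin.ext_iff]; omega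
    simp only [h3] at h2
    trans sg r i * (if j = k then 1 else 0)
    · rw [← h2]; ring
    · by_cases hj : j = k
      · subst hj
        fin_cases r <;> fin_cases i <;> simp [sg]
      · simp [hj]

lemma rail_res (n : ℕ) (a b : ℤ → ℝ) (C : ℝ) (hC : C ≠ 0)
    (ha : ∀ j, a (j + 1) + a (j - 1) = 4 * a j) (hb : ∀ j, b (j + 1) + b (j - 1) = 4 * b j)
    (hW : ∀ j, a (j + 1) * b j - a j * b (j + 1) = C)
    (ha0 : a (-1) = a 0) (hbn : b n = b (n - 1)) (r : Fin 2) (k k' : Fin n)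
    (hkk : k'.val = k.val + 1) :
    effRes (ladder n) (r, k) (r, k') = 1 / 2 + (1 / 2) * (a k.val * b k.val / C
      + a (k.val + 1) * b (k.val + 1) / C - 2 * (a k.val * b (k.val + 1) / C)) := by
  have hk := k'.2
  have g0 : ∀ k : Fin n, grn a b C k.val (-1) = grn a b C k.val 0 := by
    intro k
    unfold grn; rw [if_pos (by omega), if_pos (by omega), ha0]
  have gn : ∀ k : Fin n, grn a b C k.val n = grn a b C k.val (n - 1) := by
    intro k
    have := k.2
    unfold grn; rw [if_neg (by omega)]
    split_ifs with h
    · have : (k.val : ℤ) = n - 1 := by omega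
      rw [this, hbn]
    · rw [hbn]
  let v : Fin 2 → ℤ → ℝ := fun i j => (if j ≤ k.val then 1 / 2 else 0) +
    sg r i * (1 / 2) * (grn a b C k.val j - grn a b C k'.val j)
  have hk'' : (k'.val : ℤ) = k.val + 1 := by omega
  rw [effRes_eq (ladder n) _ _ (fun w => v w.1 w.2.val)]
  · simp [v, sg, grn, hk'']; ring
  · rintro ⟨i, j⟩
    have := ladder_lap n v
      (fun i => by simp only [v, g0]; rw [if_pos (by omega), if_pos (by omega)])
      (fun i => by simp only [v, gn]; rw [if_neg (by omega), if_neg (by omega)]) i j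
    simp only at this ⊢
    rw [this]
    simp only [v, sg_neg]
    have h2 := grn_eq a b C hC ha hb hW k.val j.val
    have h2' := grn_eq a b C hC ha hb hW k'.val j.val
    have h3 : ∀ k : Fin n, ((j.val : ℤ) = k.val) ↔ j = k := by
      intro k; rw [Fin.ext_iff]; omega
    simp only [h3] at h2 h2'
    have hst : 2 * (if (j.val : ℤ) ≤ k.val then (1 / 2 : ℝ) else 0)
        - (if (j.val : ℤ) + 1 ≤ k.val then (1 / 2 : ℝ) else 0)
        - (if (j.val : ℤ) - 1 ≤ k.val then (1 / 2 : ℝ) else 0)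
        = (1 / 2) * (if j = k then 1 else 0) - (1 / 2) * (if j = k' then 1 else 0) := by
      simp only [Fin.ext_iff, hkk]
      split_ifs <;> first | omega | norm_num
    trans ((1 / 2) * (if j = k then 1 else 0) - (1 / 2) * (if j = k' then 1 else 0)) +
      sg r i * (1 / 2) * ((if j = k then 1 else 0) - (if j = k' then 1 else 0))
    · rw [← hst]
      linear_combination (sg r i * (1 / 2)) * (h2 - h2')
    · by_cases hi : i = r
      · simp only [sg, hi, Prod.mk.injEq, true_and, false_and, if_true, if_false]; ring
      · simp only [sg, hi, Prod.mk.injEq, true_and, false_and, if_true, if_false]; ring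

lemma curv_aux (n k : ℕ) (hk : 0 < k) (hkn : k + 1 < n) (i : Fin 2)
    (a b : ℤ → ℝ) (C : ℝ) (hC : 0 < C)
    (ha : ∀ j, a (j + 1) + a (j - 1) = 4 * a j) (hb : ∀ j, b (j + 1) + b (j - 1) = 4 * b j)
    (hW : ∀ j, a (j + 1) * b j - a j * b (j + 1) = C)
    (ha0 : a (-1) = a 0) (hbn : b n = b (n - 1))
    (hconv : ∀ j, 2 * (a j * b j) < a (j + 1) * b (j + 1) + a (j - 1) * b (j - 1)) :
    curv (ladder n) (i, ⟨k, by omega⟩) < 0 := by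
  unfold curv
  have hs := ladder_sum n i ⟨k, by omega⟩ (fun y => effRes (ladder n) (i, ⟨k, by omega⟩) y)
  simp only at hs
  rw [hs, dif_pos hkn, dif_pos hk, rung_res n a b C hC.ne' ha hb hW ha0 hbn,
    rail_res n a b C hC.ne' ha hb hW ha0 hbn i ⟨k, by omega⟩ ⟨k + 1, hkn⟩ rfl,
    effRes_comm, rail_res n a b C hC.ne' ha hb hW ha0 hbn i ⟨k - 1, by omega⟩ ⟨k, by omega⟩
      (by simp only; omega)]
  simp only
  have hc : ((k - 1 : ℕ) : ℤ) = (k : ℤ) - 1 := by omega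
  rw [hc, sub_add_cancel]
  have h1 := hconv k
  have h2 := hW k
  have h3 := ha k
  have h4 := hb k
  have key : 0 < (a (k + 1) * b (k + 1) + a (k - 1) * b (k - 1) - 2 * (a k * b k)) / C :=
    div_pos (by linarith) hC
  have h5 : (a k * b (k + 1) + a (k - 1) * b k) / C = 4 * (a k * b k / C) - 1 := by
    field_simp
    linear_combination b k * h3 - h2
  simp only [sub_div, add_div, mul_div_assoc (2 : ℝ)] at key h5
  linarith

theorem mid_curv_neg (n k : ℕ) (hk1 : 1 < k) (hkn : k < n) (i : Fin 2) :
    curv (ladder n) (i, ⟨k - 1, by omega⟩) < 0 := by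
  obtain ⟨t, ht0, ht⟩ : ∃ t : ℝ, 0 < t ∧ Real.cosh t = 2 :=
    ⟨Real.arcosh 2, Real.arcosh_pos (by norm_num), Real.cosh_arcosh (by norm_num)⟩
  have hrec : ∀ x : ℝ, Real.cosh (x + t) + Real.cosh (x - t) = 4 * Real.cosh x := by
    intro x
    rw [Real.cosh_add, Real.cosh_sub, ht]; ring
  apply curv_aux n (k - 1) (by omega) (by omega) i
    (fun j => Real.cosh ((j + 1 / 2) * t)) (fun j => Real.cosh ((n - j - 1 / 2) * t))
    (Real.sinh t * Real.sinh (n * t))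
  · have : (0 : ℝ) < n := by exact_mod_cast (by omega : 0 < n)
    exact mul_pos (Real.sinh_pos_iff.2 ht0) (Real.sinh_pos_iff.2 (by positivity))
  · intro j
    rw [← hrec]; push_cast
    congr 2 <;> ring
  · intro j
    rw [← hrec, add_comm]; push_cast
    congr 2 <;> ring
  · intro j
    push_cast
    set u : ℝ := (j + 1 / 2) * t with hu
    set w : ℝ := (n - j - 1 / 2) * t with hw
    have e1 : ((j : ℝ) + 1 + 1 / 2) * t = u + t := by rw [hu]; ring
    have e2 : ((n : ℝ) - (j + 1) - 1 / 2) * t = w - t := by rw [hw]; ring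
    have e3 : (n : ℝ) * t = u + w := by rw [hu, hw]; ring
    rw [e1, e2, e3, Real.cosh_add, Real.cosh_sub, Real.sinh_add]; ring
  · rw [← Real.cosh_neg]; push_cast; congr 1; ring
  · rw [← Real.cosh_neg]; push_cast; congr 1; ring
  · intro j
    push_cast
    set u : ℝ := (j + 1 / 2) * t with hu
    set w : ℝ := (n - j - 1 / 2) * t with hw
    have e1 : ((j : ℝ) + 1 + 1 / 2) * t = u + t := by rw [hu]; ring
    have e2 : ((n : ℝ) - (j + 1) - 1 / 2) * t = w - t := by rw [hw]; ring
    have e3 : ((j : ℝ) - 1 + 1 / 2) * t = u - t := by rw [hu]; ring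
    have e4 : ((n : ℝ) - (j - 1) - 1 / 2) * t = w + t := by rw [hw]; ring
    rw [e1, e2, e3, e4]
    have hp := Real.cosh_pos (u - w)
    rw [Real.cosh_sub] at hp
    simp only [Real.cosh_add, Real.cosh_sub, ht]
    have hsq : Real.sinh t ^ 2 = 3 := by rw [Real.sinh_sq, ht]; norm_num
    have e5 : (Real.cosh u * 2 + Real.sinh u * Real.sinh t) *
          (Real.cosh w * 2 - Real.sinh w * Real.sinh t) +
        (Real.cosh u * 2 - Real.sinh u * Real.sinh t) *
          (Real.cosh w * 2 + Real.sinh w * Real.sinh t)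
        = 8 * (Real.cosh u * Real.cosh w) - 6 * (Real.sinh u * Real.sinh w) := by
      linear_combination (-2 * Real.sinh u * Real.sinh w) * hsq
    rw [e5]; linarith
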